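/- Let L ≥ 4 and consider the antisymmetric folded XXZ Hamiltonian on a periodic chain of 2L qubits, H = Σ_{j=0}^{2L−1} ((1 + Z_j Z_{j+3})/2)(X_{j+1} Y_{j+2} − Y_{j+1} X_{j+2}) with indices mod 2L. Then for every complex number c, the crosscap state |Ψ(c)⟩ built from A = diag(1, c) satisfies H |Ψ(c)⟩ = 0. -/

import Mathlib

open Matrix BigOperators

/-- The site `j + k` modulo the chain length `n`. -/
def shiftSite {n : ℕ} (j : Fin n) (k : ℕ) : Fin n :=
  ⟨(j.val + k) % n, Nat.mod_lt _ (Nat.lt_of_le_of_lt (Nat.zero_le _) j.isLt)⟩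

/-- Site `j` (for `j < L`) viewed as a site of the chain of length `2*L`. -/
def lo {L : ℕ} (j : Fin L) : Fin (2 * L) := ⟨j.val, by have := j.isLt; omega⟩

/-- The antipodal site `j + L` of the chain of length `2*L`. -/
def hi {L : ℕ} (j : Fin L) : Fin (2 * L) := ⟨j.val + L, by have := j.isLt; omega⟩

/-- The crosscap state built from the `D × D` matrix `A` on a periodic chain of `2*L` sites:
its coefficient on the computational basis state `f` is `∏_{j=0}^{L-1} A (f j) (f (j+L))`. -/
noncomputable def crosscap (L D : ℕ) (A : Matrix (Fin D) (Fin D) ℂ) :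
    (Fin (2 * L) → Fin D) → ℂ :=
  fun f => ∏ j : Fin L, A (f (lo j)) (f (hi j))

/-- The translate `h(j)` of a local operator `h` of range `r`, acting on the sites
`j, j+1, …, j+r-1` (mod `n`) of a periodic chain of `n` sites, and as the identity elsewhere. -/
noncomputable def localOp {n D : ℕ} (r : ℕ)
    (h : Matrix (Fin r → Fin D) (Fin r → Fin D) ℂ) (j : Fin n) :
    Matrix (Fin n → Fin D) (Fin n → Fin D) ℂ :=
  Matrix.of fun f g =>
    h (fun k => f (shiftSite j k.val)) (fun k => g (shiftSite j k.val)) *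
      ∏ i : Fin n, if (∃ k : Fin r, i = shiftSite j k.val) ∨ f i = g i then 1 else 0

/-- The `r`-fold Kronecker power `A^{⊗r}` of a `D × D` matrix `A`. -/
noncomputable def kronPow {D : ℕ} (r : ℕ) (A : Matrix (Fin D) (Fin D) ℂ) :
    Matrix (Fin r → Fin D) (Fin r → Fin D) ℂ :=
  Matrix.of fun f g => ∏ k : Fin r, A (f k) (g k)

/-- The one-site operator `M` acting at site `j`, identity elsewhere. -/
noncomputable def oneSite {n D : ℕ} (M : Matrix (Fin D) (Fin D) ℂ) (j : Fin n) :
    Matrix (Fin n → Fin D) (Fin n → Fin D) ℂ :=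
  Matrix.of fun f g => M (f j) (g j) * ∏ i : Fin n, if i = j ∨ f i = g i then 1 else 0

/-- The Pauli matrix `X`. -/
noncomputable def PX : Matrix (Fin 2) (Fin 2) ℂ := !![0, 1; 1, 0]

/-- The Pauli matrix `Y`. -/
noncomputable def PY : Matrix (Fin 2) (Fin 2) ℂ := !![0, -Complex.I; Complex.I, 0]

/-- The Pauli matrix `Z`. -/
noncomputable def PZ : Matrix (Fin 2) (Fin 2) ℂ := !![1, 0; 0, -1]

/-- The spin raising operator `σ⁺ = |1⟩⟨0|`. -/
noncomputable def sigmaPlus : Matrix (Fin 2) (Fin 2) ℂ := !![0, 0; 1, 0]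

lemma oneSite_mulVec_apply {n D : ℕ} (M : Matrix (Fin D) (Fin D) ℂ) (j : Fin n)
    (v : (Fin n → Fin D) → ℂ) (f : Fin n → Fin D) :
    (oneSite M j).mulVec v f = ∑ s, M (f j) s * v (Function.update f j s) := by
  symm
  refine Fintype.sum_of_injective (Function.update f j) (Function.update_injective f j) _ _ ?_ ?_
  · intro g hg
    have hne : ∃ i, ¬(i = j ∨ f i = g i) := by
      by_contra! h
      refine hg ⟨g j, ?_⟩
      funext i
      by_cases hi : i = j
      · subst hi; simp
      · simpa [hi] using h i
    obtain ⟨i, hi⟩ := hne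
    have : ∏ i : Fin n, (if i = j ∨ f i = g i then (1 : ℂ) else 0) = 0 :=
      Finset.prod_eq_zero (Finset.mem_univ i) (if_neg hi)
    simp [oneSite, this]
  · intro s
    have : ∏ i : Fin n, (if i = j ∨ f i = Function.update f j s i then (1 : ℂ) else 0) = 1 := by
      refine Finset.prod_eq_one fun i _ => if_pos ?_
      by_cases hi : i = j <;> simp [hi]
    simp [oneSite, this]

lemma PX_mulVec_apply {n : ℕ} (j : Fin n) (v : (Fin n → Fin 2) → ℂ) (f : Fin n → Fin 2) :
    (oneSite PX j).mulVec v f = v (Function.update f j (f j + 1)) := by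
  rw [oneSite_mulVec_apply]
  generalize f j = s
  fin_cases s <;> simp [PX]

/-- The nonzero matrix element of `PY` in the row `s`. -/
noncomputable def ySign (s : Fin 2) : ℂ := ![-Complex.I, Complex.I] s

/-- The diagonal entry of `PZ` in the row `s`. -/
noncomputable def zSign (s : Fin 2) : ℂ := ![1, -1] s

lemma PY_mulVec_apply {n : ℕ} (j : Fin n) (v : (Fin n → Fin 2) → ℂ) (f : Fin n → Fin 2) :
    (oneSite PY j).mulVec v f = ySign (f j) * v (Function.update f j (f j + 1)) := by
  rw [oneSite_mulVec_apply]
  generalize f j = s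
  fin_cases s <;> simp [PY, ySign]

lemma PZ_mulVec_apply {n : ℕ} (j : Fin n) (v : (Fin n → Fin 2) → ℂ) (f : Fin n → Fin 2) :
    (oneSite PZ j).mulVec v f = zSign (f j) * v f := by
  rw [oneSite_mulVec_apply]
  have hu := Function.update_eq_self j f
  obtain h | h : f j = 0 ∨ f j = 1 := by omega
  all_goals
    rw [h] at hu
    simp [PZ, zSign, h, hu]

/-- The indicator of the two sites `a` and `b`. -/
def pairIndicator {n : ℕ} (a b : Fin n) : Fin n → Fin 2 :=
  fun i => if i = a ∨ i = b then 1 else 0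

lemma update_update_eq_add_pairIndicator {n : ℕ} {a b : Fin n} (hab : a ≠ b)
    (f : Fin n → Fin 2) :
    Function.update (Function.update f a (f a + 1)) b (f b + 1) = f + pairIndicator a b := by
  funext i
  by_cases hb : i = b
  · subst hb; simp [pairIndicator]
  · by_cases ha : i = a
    · subst ha; simp [pairIndicator, hb]
    · simp [pairIndicator, ha, hb]

lemma folded_term_mulVec_apply {n : ℕ} (j a b k : Fin n) (hab : a ≠ b)
    (v : (Fin n → Fin 2) → ℂ) (f : Fin n → Fin 2) :
    (((2 : ℂ)⁻¹ • (1 + oneSite PZ j * oneSite PZ k)) *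
      (oneSite PX a * oneSite PY b - oneSite PY a * oneSite PX b)).mulVec v f =
      2⁻¹ * (1 + zSign (f j) * zSign (f k)) * (ySign (f b) - ySign (f a)) *
        v (f + pairIndicator a b) := by
  simp only [← Matrix.mulVec_mulVec, Matrix.smul_mulVec, Matrix.add_mulVec, Matrix.sub_mulVec,
    Matrix.one_mulVec, Pi.smul_apply, Pi.add_apply, Pi.sub_apply, PX_mulVec_apply,
    PY_mulVec_apply, PZ_mulVec_apply, smul_eq_mul, Function.update_of_ne hab.symm,
    update_update_eq_add_pairIndicator hab]
  ring

lemma sum_fin_two_mul_eq_sum_lo_add_hi {L : ℕ} (w : Fin (2 * L) → ℕ) :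
    ∑ i, w i = ∑ j : Fin L, w (lo j) + ∑ j : Fin L, w (hi j) := by
  rw [← (finCongr (two_mul L).symm).sum_comp, Fin.sum_univ_add]
  congr 1
  refine Finset.sum_congr rfl fun j _ => congrArg w (Fin.ext ?_)
  simp [hi, add_comm]

lemma shiftSite_lo {L : ℕ} (j : Fin L) : shiftSite (lo j) L = hi j := by
  have := j.isLt
  exact Fin.ext (Nat.mod_eq_of_lt (by simp only [lo]; omega))

lemma shiftSite_hi {L : ℕ} (j : Fin L) : shiftSite (hi j) L = lo j := by
  have := j.isLt
  refine Fin.ext ?_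
  simp only [shiftSite, hi, lo]
  rw [show j.val + L + L = j.val + 2 * L by ring, Nat.add_mod_right, Nat.mod_eq_of_lt (by omega)]

lemma eq_lo_or_eq_hi {L : ℕ} (i : Fin (2 * L)) : ∃ j : Fin L, i = lo j ∨ i = hi j := by
  have := i.isLt
  by_cases h : i.val < L
  · exact ⟨⟨i.val, h⟩, Or.inl rfl⟩
  · exact ⟨⟨i.val - L, by omega⟩, Or.inr (Fin.ext (by simp only [hi]; omega))⟩

lemma shiftSite_shiftSite_self {L : ℕ} (i : Fin (2 * L)) :
    shiftSite (shiftSite i L) L = i := by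
  obtain ⟨j, rfl | rfl⟩ := eq_lo_or_eq_hi i <;> simp [shiftSite_lo, shiftSite_hi]

lemma shiftSite_comm {n : ℕ} (j : Fin n) (k l : ℕ) :
    shiftSite (shiftSite j k) l = shiftSite (shiftSite j l) k := by
  refine Fin.ext ?_
  simp only [shiftSite, Nat.mod_add_mod]
  congr 1
  ring

/-- A crosscap state built from `diag(1, c)` is supported on antipodally symmetric configurations,
where its coefficient depends only on the number of sites in the state `1`. -/
lemma crosscap_diagonal_apply {L : ℕ} (c : ℂ) (f : Fin (2 * L) → Fin 2)
    [Decidable (∀ i, f (shiftSite i L) = f i)] :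
    crosscap L 2 (Matrix.diagonal ![1, c]) f =
      if ∀ i, f (shiftSite i L) = f i then c ^ ((∑ i, (f i).val) / 2) else 0 := by
  split_ifs with h
  · have hf : ∀ j : Fin L, f (hi j) = f (lo j) := fun j => by rw [← shiftSite_lo, h]
    have hsum : (∑ i, (f i).val) / 2 = ∑ j : Fin L, (f (lo j)).val := by
      rw [sum_fin_two_mul_eq_sum_lo_add_hi]
      simp only [hf]
      omega
    rw [hsum, ← Finset.prod_pow_eq_pow_sum]
    refine Finset.prod_congr rfl fun j _ => ?_
    rw [hf]
    generalize f (lo j) = s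
    fin_cases s <;> simp
  · push Not at h
    obtain ⟨i, hne⟩ := h
    obtain ⟨j, hj⟩ := eq_lo_or_eq_hi i
    refine Finset.prod_eq_zero (Finset.mem_univ j) (Matrix.diagonal_apply_ne _ ?_)
    rcases hj with rfl | rfl
    · rwa [shiftSite_lo, ne_comm] at hne
    · rwa [shiftSite_hi] at hne

lemma sum_val_add_pairIndicator {n : ℕ} {a b : Fin n} {f : Fin n → Fin 2} (h : f a ≠ f b) :
    ∑ i, ((f + pairIndicator a b) i).val = ∑ i, (f i).val := by
  rw [← Equiv.sum_comp (Equiv.swap a b) (fun i => (f i).val)]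
  refine Finset.sum_congr rfl fun i _ => congrArg Fin.val ?_
  by_cases ha : i = a
  · subst ha
    simp only [pairIndicator, Pi.add_apply, true_or, if_true, Equiv.swap_apply_left]
    omega
  · by_cases hb : i = b
    · subst hb
      simp only [pairIndicator, Pi.add_apply, or_true, if_true, Equiv.swap_apply_right]
      omega
    · simp [pairIndicator, ha, hb, Equiv.swap_apply_of_ne_of_ne ha hb]

lemma pairIndicator_shiftSite {L : ℕ} (a b i : Fin (2 * L)) :
    pairIndicator (shiftSite a L) (shiftSite b L) i = pairIndicator a b (shiftSite i L) := by
  have key (x : Fin (2 * L)) : i = shiftSite x L ↔ shiftSite i L = x :=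
    ⟨fun h => by rw [h, shiftSite_shiftSite_self], fun h => by rw [← h, shiftSite_shiftSite_self]⟩
  simp only [pairIndicator, key]

lemma symmetric_add_pairIndicator {L : ℕ} {a b : Fin (2 * L)} {f : Fin (2 * L) → Fin 2}
    (h : ∀ i, (f + pairIndicator a b) (shiftSite i L) = (f + pairIndicator a b) i)
    (i : Fin (2 * L)) :
    (f + pairIndicator (shiftSite a L) (shiftSite b L)) (shiftSite i L) =
      (f + pairIndicator (shiftSite a L) (shiftSite b L)) i := by
  have := h i
  simp only [Pi.add_apply, pairIndicator_shiftSite, shiftSite_shiftSite_self] at this ⊢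
  omega

lemma folded_term_add_antipodal {L : ℕ} (c : ℂ) (f : Fin (2 * L) → Fin 2) {j a b k : Fin (2 * L)}
    (ha : pairIndicator a b (shiftSite a L) = 0) (hb : pairIndicator a b (shiftSite b L) = 0)
    (hj : pairIndicator a b j = pairIndicator a b (shiftSite j L))
    (hk : pairIndicator a b k = pairIndicator a b (shiftSite k L)) :
    2⁻¹ * (1 + zSign (f j) * zSign (f k)) * (ySign (f b) - ySign (f a)) *
        crosscap L 2 (Matrix.diagonal ![1, c]) (f + pairIndicator a b) +
      2⁻¹ * (1 + zSign (f (shiftSite j L)) * zSign (f (shiftSite k L))) *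
        (ySign (f (shiftSite b L)) - ySign (f (shiftSite a L))) *
        crosscap L 2 (Matrix.diagonal ![1, c])
          (f + pairIndicator (shiftSite a L) (shiftSite b L)) = 0 := by
  classical
  rw [crosscap_diagonal_apply, crosscap_diagonal_apply]
  by_cases h : ∀ i, (f + pairIndicator a b) (shiftSite i L) = (f + pairIndicator a b) i
  · rw [if_pos h, if_pos (symmetric_add_pairIndicator h)]
    have hja := h j
    have hka := h k
    have haa := h a
    have hba := h b
    simp only [Pi.add_apply, hj, hk, add_left_inj] at hja hka
    have h1 : pairIndicator a b a = 1 := by simp [pairIndicator]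
    have h2 : pairIndicator a b b = 1 := by simp [pairIndicator]
    simp only [Pi.add_apply, ha, hb, h1, h2, add_zero] at haa hba
    have hy (s : Fin 2) : ySign (s + 1) = -ySign s := by fin_cases s <;> simp [ySign]
    by_cases hab : f a = f b
    · simp [haa, hba, hab]
    · rw [sum_val_add_pairIndicator hab, sum_val_add_pairIndicator (by rw [haa, hba]; omega),
        hja, hka, haa, hba, hy, hy]
      ring
  · have h' : ¬ ∀ i, (f + pairIndicator (shiftSite a L) (shiftSite b L)) (shiftSite i L) =
        (f + pairIndicator (shiftSite a L) (shiftSite b L)) i := fun h' => h <| by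
      simpa only [shiftSite_shiftSite_self] using symmetric_add_pairIndicator h'
    rw [if_neg h, if_neg h']
    ring

lemma shiftSite_inj_of_lt {n : ℕ} (j : Fin n) {k l : ℕ} (hk : k < n) (hl : l < n) :
    shiftSite j k = shiftSite j l ↔ k = l := by
  refine ⟨fun h => ?_, fun h => h ▸ rfl⟩
  have h' : j.val + k ≡ j.val + l [MOD n] := congrArg Fin.val h
  exact (Nat.ModEq.add_left_cancel' _ h').eq_of_lt_of_lt hk hl

lemma shiftSite_add {n : ℕ} (j : Fin n) (k l : ℕ) :
    shiftSite (shiftSite j k) l = shiftSite j (k + l) := by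
  refine Fin.ext ?_
  simp only [shiftSite, Nat.mod_add_mod, add_assoc]

lemma shiftSite_zero {n : ℕ} (j : Fin n) : shiftSite j 0 = j :=
  Fin.ext (Nat.mod_eq_of_lt j.isLt)

lemma pairIndicator_shiftSite_eq_zero {n : ℕ} (j : Fin n) {k : ℕ} (hn : 2 < n) (hk : k < n)
    (h1 : k ≠ 1) (h2 : k ≠ 2) :
    pairIndicator (shiftSite j 1) (shiftSite j 2) (shiftSite j k) = 0 := by
  simp [pairIndicator, shiftSite_inj_of_lt j hk (show 1 < n by omega),
    shiftSite_inj_of_lt j hk hn, h1, h2]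

/-- the antisymmetric folded XXZ Hamiltonian
`H = Σ_j ((1 + Z_j Z_{j+3})/2)(X_{j+1} Y_{j+2} - Y_{j+1} X_{j+2})` on a periodic chain of `2L`
qubits annihilates, for every `c ∈ ℂ`, the crosscap state `|Ψ(c)⟩` built from `A = diag(1, c)`. -/
theorem antisymmetric_folded_xxz_crosscap (L : ℕ) (hL : 4 ≤ L) (c : ℂ) :
    (∑ j : Fin (2 * L),
        ((2 : ℂ)⁻¹ • (1 + oneSite PZ j * oneSite PZ (shiftSite j 3))) *
          (oneSite PX (shiftSite j 1) * oneSite PY (shiftSite j 2) -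
            oneSite PY (shiftSite j 1) * oneSite PX (shiftSite j 2))).mulVec
      (crosscap L 2 (Matrix.diagonal ![1, c])) = 0 := by
  funext f
  rw [Matrix.sum_mulVec, Finset.sum_apply, Pi.zero_apply]
  have hne (j : Fin (2 * L)) : shiftSite j 1 ≠ shiftSite j 2 := by
    rw [Ne, shiftSite_inj_of_lt j (by omega) (by omega)]
    decide
  have h0 (j : Fin (2 * L)) {k : ℕ} (hk : k < 2 * L) (h1 : k ≠ 1) (h2 : k ≠ 2) :=
    pairIndicator_shiftSite_eq_zero j (by omega) hk h1 h2
  refine Finset.sum_involution (fun j _ => shiftSite j L) ?_ ?_ (fun _ _ => Finset.mem_univ _)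
    (fun j _ => shiftSite_shiftSite_self j)
  · intro j _
    rw [folded_term_mulVec_apply _ _ _ _ (hne _), folded_term_mulVec_apply _ _ _ _ (hne _),
      shiftSite_comm j L 1, shiftSite_comm j L 2, shiftSite_comm j L 3]
    have hj := h0 j (k := 0) (by omega) (by omega) (by omega)
    rw [shiftSite_zero] at hj
    apply folded_term_add_antipodal
    · rw [shiftSite_add, h0 j (by omega) (by omega) (by omega)]
    · rw [shiftSite_add, h0 j (by omega) (by omega) (by omega)]
    · rw [hj, h0 j (by omega) (by omega) (by omega)]
    · rw [shiftSite_add, h0 j (by omega) (by omega) (by omega),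
        h0 j (by omega) (by omega) (by omega)]
  · intro j _ _ h
    have := (shiftSite_inj_of_lt j (k := L) (l := 0) (by omega) (by omega)).1
      (h.trans (shiftSite_zero j).symm)
    omega
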